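/- Let V be a Jordan triple system in which orthogonality is symmetric. Let w ∈ V be a maximal tripotent, let v ∈ V be a tripotent with v ≤ w (w − v is a tripotent orthogonal to v), and let u ∈ V be a tripotent with D(w,w)u = u/2 which is collinear to v (D(v,v)u = u/2 and D(u,u)v = v/2). Assume that the only x ∈ V satisfying D(w,w)x = x/2, D(u,u)x = x/2 and D(v,v)x = 0 is x = 0. Then every tripotent e ∈ V with D(v,v)e = e/2 and D(w−v,w−v)e = e/2 is zero. -/

import Mathlib

/-- A Jordan triple system: a complex vector space with a triple product
symmetric and linear in the outer variables, conjugate-linear in the middle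
variable, satisfying the Jordan triple (main) identity. -/
structure JordanTriple (V : Type*) [AddCommGroup V] [Module ℂ V] where
  tp : V → V → V → V
  symm_outer : ∀ a b c, tp a b c = tp c b a
  add_fst : ∀ a a' b c, tp (a + a') b c = tp a b c + tp a' b c
  smul_fst : ∀ (r : ℂ) (a b c : V), tp (r • a) b c = r • tp a b c
  add_snd : ∀ a b b' c, tp a (b + b') c = tp a b c + tp a b' c
  smul_snd : ∀ (r : ℂ) (a b c : V), tp a (r • b) c = (starRingEnd ℂ r) • tp a b c
  jordan_identity : ∀ a b x y z,
    tp a b (tp x y z) = tp (tp a b x) y z - tp x (tp b a y) z + tp x y (tp a b z)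

namespace JordanTriple

variable {V : Type*} [AddCommGroup V] [Module ℂ V]

/-- A tripotent: `{e,e,e} = e`. -/
def IsTripotent (T : JordanTriple V) (e : V) : Prop := T.tp e e e = e

/-- Orthogonality of elements: `D(x,y) = 0` and `D(y,x) = 0`. -/
def Orthogonal (T : JordanTriple V) (x y : V) : Prop :=
  (∀ z, T.tp x y z = 0) ∧ (∀ z, T.tp y x z = 0)

/-- A maximal (complete) tripotent: the Peirce projection
`P₀(w) = I - 2 D(w,w) + Q(w)²` vanishes on `V`. -/
def IsMaximalTripotent (T : JordanTriple V) (w : V) : Prop :=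
  T.IsTripotent w ∧ ∀ z : V, z - (2 : ℂ) • T.tp w w z + T.tp w (T.tp w z w) w = 0

/-- Orthogonality is symmetric: `D(a,a)b = 0` implies `D(b,b)a = 0`
(true in every JB*-triple). -/
def OrthSymm (T : JordanTriple V) : Prop :=
  ∀ a b : V, T.tp a a b = 0 → T.tp b b a = 0

end JordanTriple

variable {V : Type*} [AddCommGroup V] [Module ℂ V]

open JordanTriple

namespace JordanTriple

theorem zero_fst (T : JordanTriple V) (b c : V) : T.tp 0 b c = 0 := by
  simpa using T.smul_fst 0 0 b c

theorem zero_snd (T : JordanTriple V) (a c : V) : T.tp a 0 c = 0 := by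
  simpa using T.smul_snd 0 a 0 c

theorem zero_trd (T : JordanTriple V) (a b : V) : T.tp a b 0 = 0 := by
  rw [T.symm_outer, T.zero_fst]

theorem smul_trd (T : JordanTriple V) (r : ℂ) (a b c : V) :
    T.tp a b (r • c) = r • T.tp a b c := by
  rw [T.symm_outer, T.smul_fst, T.symm_outer]

theorem add_trd (T : JordanTriple V) (a b c c' : V) :
    T.tp a b (c + c') = T.tp a b c + T.tp a b c' := by
  rw [T.symm_outer, T.add_fst, T.symm_outer, T.symm_outer c']

/-- Peirce arithmetic: eigenvectors of `D(a,a)` multiply to an eigenvector. -/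
theorem tp_self_tp (T : JordanTriple V) {a x y z : V} {α β γ : ℂ}
    (hx : T.tp a a x = α • x) (hy : T.tp a a y = β • y) (hz : T.tp a a z = γ • z) :
    T.tp a a (T.tp x y z) = (α - starRingEnd ℂ β + γ) • T.tp x y z := by
  rw [T.jordan_identity, hx, hy, hz, T.smul_fst, T.smul_snd, T.smul_trd, add_smul, sub_smul]

/-- A tripotent is orthogonal to its Peirce-0 space. -/
theorem IsTripotent.orthogonal {T : JordanTriple V} {g x : V} (hg : T.IsTripotent g)
    (hx : T.tp g g x = 0) : T.Orthogonal g x := by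
  have hg' : T.tp g g g = g := hg
  have hx' : T.tp x g g = 0 := by rw [T.symm_outer, hx]
  have hQ : T.tp g x g = 0 := by
    have h1 := T.jordan_identity g x g g g
    have h2 := T.jordan_identity g g g x g
    rw [hg', hx', T.zero_snd, T.symm_outer (T.tp g x g)] at h1
    rw [hg', hx, T.zero_snd] at h2
    rw [h2] at h1
    have h3 : (3 : ℂ) • T.tp g x g = 0 := by
      linear_combination (norm := module) -h1
    simpa using h3
  constructor
  · intro z
    have h1 := T.jordan_identity g x g g z
    have h2 := T.jordan_identity g g g x z
    rw [hx', hQ, T.zero_fst, T.zero_snd] at h1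
    rw [hg', hx, T.zero_snd] at h2
    linear_combination (norm := module) -h1 - h2
  · intro z
    have h1 := T.jordan_identity x g g g z
    have h2 := T.jordan_identity g g x g z
    rw [hx', hQ, T.zero_fst, T.zero_snd] at h1
    rw [hg', hx, T.zero_fst] at h2
    linear_combination (norm := module) h1 + h2

/-- If `a` is orthogonal to `b`, then `D(a,a)` vanishes on the range of `Q(b)`. -/
theorem Orthogonal.tp_self_quad {T : JordanTriple V} {a b : V} (h : T.Orthogonal a b) (c : V) :
    T.tp a a (T.tp b c b) = 0 := by
  have h1 := T.jordan_identity b c a a b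
  rw [T.symm_outer a a b, h.2, T.zero_trd, T.symm_outer _ a b, h.2, T.symm_outer c b a, h.1,
    T.zero_snd] at h1
  linear_combination (norm := module) -h1

/-- For a tripotent `u`, `Q(u)² = 2 D(u,u)² - D(u,u)`. -/
theorem IsTripotent.quad_quad {T : JordanTriple V} {u : V} (hu : T.IsTripotent u) (x : V) :
    T.tp u (T.tp u x u) u = (2 : ℂ) • T.tp u u (T.tp u u x) - T.tp u u x := by
  have h1 := T.jordan_identity x u u u u
  rw [show T.tp u u u = u from hu, T.symm_outer x u u, T.symm_outer (T.tp u u x) u u] at h1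
  linear_combination (norm := module) h1

end JordanTriple

/-- Assume orthogonality is symmetric.  Let `w` be a maximal tripotent, `v` a
tripotent with `v ≤ w`, and `u` a tripotent in `V₁(w)` collinear to `v`.  If
`V₁(w) ∩ V₁(u) ∩ V₀(v) = 0`, then every tripotent `e ∈ V₁(v) ∩ V₁(w - v)`
is zero. -/
theorem horn_lemma (T : JordanTriple V) (hOS : T.OrthSymm) (w v u : V)
    (hw : T.IsMaximalTripotent w) (hv : T.IsTripotent v)
    (hvw : T.IsTripotent (w - v) ∧ T.Orthogonal (w - v) v)
    (hu : T.IsTripotent u)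
    (hu1 : T.tp w w u = (1/2 : ℂ) • u)
    (hcol1 : T.tp v v u = (1/2 : ℂ) • u)
    (hcol2 : T.tp u u v = (1/2 : ℂ) • v)
    (hzero : ∀ x : V, T.tp w w x = (1/2 : ℂ) • x →
      T.tp u u x = (1/2 : ℂ) • x → T.tp v v x = 0 → x = 0) :
    ∀ e : V, T.IsTripotent e → T.tp v v e = (1/2 : ℂ) • e →
      T.tp (w - v) (w - v) e = (1/2 : ℂ) • e → e = 0 := by
  obtain ⟨hg, hgv⟩ := hvw
  set g := w - v with hgdef
  have hDw (x : V) : T.tp w w x = T.tp v v x + T.tp g g x := by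
    have hwg : w = v + g := by rw [hgdef]; abel
    rw [hwg, T.add_fst, T.add_snd, T.add_snd, hgv.1, hgv.2]
    abel
  have hgu : T.tp g g u = 0 := by
    have h := hDw u
    rw [hu1, hcol1] at h
    simpa using h
  have hGU := hg.orthogonal hgu
  have hvg : T.tp v v g = (0 : ℂ) • g := by rw [T.symm_outer, hgv.1, zero_smul]
  have hgv' : T.tp g g v = (0 : ℂ) • v := by rw [T.symm_outer, hgv.2, zero_smul]
  have hgu' : T.tp g g u = (0 : ℂ) • u := by rw [hgu, zero_smul]
  have hug : T.tp u u g = (0 : ℂ) • g := by rw [T.symm_outer, hGU.1, zero_smul]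
  have hv1 : T.tp v v v = (1 : ℂ) • v := by rw [one_smul]; exact hv
  have hg1 : T.tp g g g = (1 : ℂ) • g := by rw [one_smul]; exact hg
  have hu2 : T.tp u u u = (1 : ℂ) • u := by rw [one_smul]; exact hu
  have hhalf : (starRingEnd ℂ) (1 / 2 : ℂ) = 1 / 2 := by
    rw [map_div₀, map_one, map_ofNat]
  have hS (x : V) (hvx : T.tp v v x = 0) (hgx : T.tp g g x = (1 / 2 : ℂ) • x)
      (hux : T.tp u u x = (1 / 2 : ℂ) • x) : x = 0 :=
    hzero x (by rw [hDw, hvx, hgx, zero_add]) hux hvx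
  intro e _ hve hge
  have hQ : T.tp u e u = 0 := by
    have h1 := T.tp_self_tp hgu' hge hgu'
    rw [hGU.tp_self_quad, hhalf] at h1
    have h2 := h1.symm
    simpa using h2
  have hD := hu.quad_quad e
  rw [hQ, T.zero_snd] at hD
  set d := T.tp u u e with hd
  have hvd : T.tp v v d = (1 / 2 : ℂ) • d := by
    have h := T.tp_self_tp hcol1 hcol1 hve
    rwa [hhalf, sub_self, zero_add] at h
  have hgd : T.tp g g d = (1 / 2 : ℂ) • d := by
    have h := T.tp_self_tp hgu' hgu' hge
    rwa [map_zero, sub_self, zero_add] at h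
  -- The Peirce-0 component of `e` relative to `u` vanishes.
  have he0 : e + (-2 : ℂ) • d = 0 := by
    set f := e + (-2 : ℂ) • d with hf
    have hvf : T.tp v v f = (1 / 2 : ℂ) • f := by
      rw [hf, T.add_trd, T.smul_trd, hve, hvd]; module
    have hgf : T.tp g g f = (1 / 2 : ℂ) • f := by
      rw [hf, T.add_trd, T.smul_trd, hge, hgd]; module
    have huf : T.tp u u f = 0 := by
      rw [hf, T.add_trd, T.smul_trd, ← hd]
      linear_combination (norm := module) hD
    have huf' : T.tp u u f = (0 : ℂ) • f := by rw [huf, zero_smul]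
    have hy : T.tp u v f = 0 := by
      apply hS
      · rw [T.tp_self_tp hcol1 hv1 hvf, map_one]; module
      · rw [T.tp_self_tp hgu' hgv' hgf, map_zero]; module
      · rw [T.tp_self_tp hu2 hcol2 huf', hhalf]; module
    have hz : T.tp v u f = 0 := by
      rw [T.symm_outer]; exact (hu.orthogonal huf).2 v
    have h := T.jordan_identity v u u v f
    rw [hy, hz, T.zero_trd, T.zero_trd, T.symm_outer v u u, hcol2, T.symm_outer u v v, hcol1,
      T.smul_fst, T.smul_snd, hvf, huf, smul_zero, smul_smul] at h
    simpa using h.symm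
  have hue : T.tp u u e = (1 / 2 : ℂ) • e := by
    rw [← hd]; linear_combination (norm := module) (-1 / 2 : ℂ) • he0
  have hx : T.tp u e g = 0 := by
    apply hS
    · rw [T.tp_self_tp hcol1 hve hvg, hhalf]; module
    · rw [T.tp_self_tp hgu' hge hg1, hhalf]; module
    · rw [T.tp_self_tp hu2 hue hug, hhalf]; module
  have heu : T.tp g g (T.tp u e e) = 0 := by
    rw [T.tp_self_tp hgu' hge hge, hhalf]; module
  have heg : T.tp e e g = 0 := by
    have h := T.jordan_identity e u u e g
    rw [hx, T.zero_trd, T.symm_outer e u u, hue, T.smul_fst, T.symm_outer u _ g,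
      (hg.orthogonal heu).1, T.symm_outer e u g, hGU.1, T.zero_trd] at h
    simpa using h.symm
  have h := hOS e g heg
  rw [hge] at h
  simpa using h
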